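/- On ℂ², let Z = {|0⟩⟨0|, |1⟩⟨1|} be the computational-basis rank-one PVM and X = {|+⟩⟨+|, |−⟩⟨−|} the Hadamard-basis rank-one PVM, where |±⟩ = (|0⟩ ± |1⟩)/√2, and let ρ = I/2 be the maximally mixed state. Then the modified context-incompatibility measure satisfies 𝔦(I/2, Z, X) = ln 2 and 𝔦(I/2, Z, Z) = 0; consequently, in the QKD-like protocol where Alice measures Z or X with probability 1/2 each and Eve measures Z or X with probability 1/2 each, the average leakage is 𝔦_avg = ¼[𝔦(I/2,Z,Z) + 𝔦(I/2,Z,X) + 𝔦(I/2,X,Z) + 𝔦(I/2,X,X)] = (1/2) ln 2 ≠ 0. -/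

import Mathlib

open Matrix BigOperators Kronecker
open scoped ComplexOrder

/-- Von Neumann entropy `S(ρ) = -∑ λᵢ ln λᵢ` of a matrix, via the eigenvalues of a
Hermitian matrix (junk value `0` if `ρ` is not Hermitian). Note `0 * Real.log 0 = 0`. -/
noncomputable def vNE {n : Type*} [Fintype n] [DecidableEq n] (ρ : Matrix n n ℂ) : ℝ :=
  if h : ρ.IsHermitian then -∑ i, (h.eigenvalues i) * Real.log (h.eigenvalues i) else 0

/-- Lüders channel `N_P(ρ) = ∑ⱼ Pⱼ ρ Pⱼ` of a family of projections `P`. -/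
noncomputable def luders {n ι : Type*} [Fintype ι] [Fintype n] (P : ι → Matrix n n ℂ)
    (ρ : Matrix n n ℂ) : Matrix n n ℂ :=
  ∑ j, P j * ρ * P j

/-- The modified context-incompatibility measure
`𝔦(ρ,X,Y) = [S(N_X ρ) - ∑_{pₓ>0} pₓ S(ρₓ)] - [S(N_Y(N_X ρ)) - ∑_{pₓ>0} pₓ S(N_Y ρₓ)]`,
where `pₓ = Tr(Xₓ ρ)` and `ρₓ = Xₓ ρ Xₓ / pₓ`. -/
noncomputable def modIPC {d : ℕ} (ρ : Matrix (Fin d) (Fin d) ℂ)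
    (X Y : Fin d → Matrix (Fin d) (Fin d) ℂ) : ℝ :=
  (vNE (luders X ρ)
      - ∑ x ∈ Finset.univ.filter (fun x => 0 < ((X x * ρ).trace).re),
          ((X x * ρ).trace).re * vNE ((((X x * ρ).trace).re)⁻¹ • (X x * ρ * X x)))
    - (vNE (luders Y (luders X ρ))
      - ∑ x ∈ Finset.univ.filter (fun x => 0 < ((X x * ρ).trace).re),
          ((X x * ρ).trace).re * vNE (luders Y ((((X x * ρ).trace).re)⁻¹ • (X x * ρ * X x))))

/-- The computational-basis PVM `Z = {|0⟩⟨0|, |1⟩⟨1|}` on ℂ². -/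
noncomputable def pvmZ : Fin 2 → Matrix (Fin 2) (Fin 2) ℂ :=
  ![!![1, 0; 0, 0], !![0, 0; 0, 1]]

/-- The Hadamard-basis PVM `X = {|+⟩⟨+|, |−⟩⟨−|}` on ℂ², `|±⟩ = (|0⟩ ± |1⟩)/√2`. -/
noncomputable def pvmX : Fin 2 → Matrix (Fin 2) (Fin 2) ℂ :=
  ![!![1/2, 1/2; 1/2, 1/2], !![1/2, -(1/2); -(1/2), 1/2]]

lemma vNE_half : vNE ((1 / 2 : ℂ) • (1 : Matrix (Fin 2) (Fin 2) ℂ)) = Real.log 2 := by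
  have hH : ((1 / 2 : ℂ) • (1 : Matrix (Fin 2) (Fin 2) ℂ)).IsHermitian := by
    ext i j
    fin_cases i <;> fin_cases j <;> simp [Matrix.conjTranspose_apply]
  have he : ∀ i, hH.eigenvalues i = 1 / 2 := by
    intro i
    have h := hH.mulVec_eigenvectorBasis i
    have hne : (hH.eigenvectorBasis i) ≠ 0 := hH.eigenvectorBasis.orthonormal.ne_zero i
    obtain ⟨k, hk⟩ : ∃ k, (hH.eigenvectorBasis i) k ≠ 0 := by
      by_contra! hc
      exact hne (by ext k; simpa using hc k)
    have h2 := congrFun h k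
    simp only [Matrix.smul_mulVec, Matrix.one_mulVec, Pi.smul_apply, smul_eq_mul,
      Complex.real_smul] at h2
    have h3 := mul_right_cancel₀ hk h2
    apply Complex.ofReal_injective
    refine Eq.trans h3.symm ?_
    norm_num
  rw [vNE, dif_pos hH]
  simp only [he, Fin.sum_univ_two]
  rw [one_div, Real.log_inv]
  ring

lemma vNE_idem (P : Matrix (Fin 2) (Fin 2) ℂ) (hP : P * P = P) : vNE P = 0 := by
  rw [vNE]
  split_ifs with hH
  · have he : ∀ i, hH.eigenvalues i = 0 ∨ hH.eigenvalues i = 1 := by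
      intro i
      have h := hH.mulVec_eigenvectorBasis i
      have hne : (hH.eigenvectorBasis i) ≠ 0 := hH.eigenvectorBasis.orthonormal.ne_zero i
      obtain ⟨k, hk⟩ : ∃ k, (hH.eigenvectorBasis i) k ≠ 0 := by
        by_contra! hc
        exact hne (by ext k; simpa using hc k)
      have h1 := congrArg (fun v => P *ᵥ v) h
      simp only [Matrix.mulVec_mulVec, hP, Matrix.mulVec_smul] at h1
      rw [h] at h1
      have h2 := congrFun h1 k
      simp only [Pi.smul_apply, Complex.real_smul, ← mul_assoc] at h2
      have h3 := mul_right_cancel₀ hk h2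
      have h4 : hH.eigenvalues i = hH.eigenvalues i * hH.eigenvalues i := by
        apply Complex.ofReal_injective
        refine Eq.trans h3 ?_
        exact (Complex.ofReal_mul _ _).symm
      by_cases h0 : hH.eigenvalues i = 0
      · exact Or.inl h0
      · right
        exact (mul_left_cancel₀ h0 (by rw [← h4, mul_one])).symm
    rw [neg_eq_zero]
    apply Finset.sum_eq_zero
    intro i _
    rcases he i with h | h <;> simp [h]
  · rfl

lemma luders_half (X : Fin 2 → Matrix (Fin 2) (Fin 2) ℂ) (hi : ∀ x, X x * X x = X x)
    (hs : ∑ x, X x = 1) : luders X ((1 / 2 : ℂ) • 1) = (1 / 2 : ℂ) • 1 := by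
  simp only [luders, Matrix.mul_smul, Matrix.smul_mul, Matrix.mul_one, hi]
  rw [← Finset.smul_sum, hs]

lemma modIPC_half (X Y : Fin 2 → Matrix (Fin 2) (Fin 2) ℂ) (hi : ∀ x, X x * X x = X x)
    (hs : ∑ x, X x = 1) (ht : ∀ x, (X x).trace = 1)
    (hi' : ∀ x, Y x * Y x = Y x) (hs' : ∑ x, Y x = 1) :
    modIPC ((1 / 2 : ℂ) • 1) X Y = (vNE (luders Y (X 0)) + vNE (luders Y (X 1))) / 2 := by
  have hp : ∀ x, ((X x * ((1 / 2 : ℂ) • 1)).trace).re = 1 / 2 := by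
    intro x
    simp [ht]
  have hr : ∀ x, (1 / 2 : ℝ)⁻¹ • (X x * ((1 / 2 : ℂ) • 1) * X x) = X x := by
    intro x
    simp only [Matrix.mul_smul, Matrix.smul_mul, Matrix.mul_one, hi]
    ext i j
    simp
  unfold modIPC
  rw [luders_half X hi hs, luders_half Y hi' hs']
  simp only [hp, hr, vNE_idem _ (hi _)]
  norm_num [Fin.sum_univ_two]
  ring

lemma Z_i (x) : pvmZ x * pvmZ x = pvmZ x := by
  fin_cases x <;> ext i j <;> fin_cases i <;> fin_cases j <;> simp [pvmZ]
lemma X_i (x) : pvmX x * pvmX x = pvmX x := by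
  fin_cases x <;> ext i j <;> fin_cases i <;> fin_cases j <;> norm_num [pvmX]
lemma Z_s : ∑ x, pvmZ x = 1 := by
  ext i j; fin_cases i <;> fin_cases j <;> simp [pvmZ]
lemma X_s : ∑ x, pvmX x = 1 := by
  ext i j; fin_cases i <;> fin_cases j <;> norm_num [pvmX]
lemma Z_t (x) : (pvmZ x).trace = 1 := by
  fin_cases x <;> simp [pvmZ, Matrix.trace]
lemma X_t (x) : (pvmX x).trace = 1 := by
  fin_cases x <;> norm_num [pvmX, Matrix.trace]
lemma ZZ (x) : luders pvmZ (pvmZ x) = pvmZ x := by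
  fin_cases x <;> ext i j <;> fin_cases i <;> fin_cases j <;> simp [luders, pvmZ]
lemma XX (x) : luders pvmX (pvmX x) = pvmX x := by
  fin_cases x <;> ext i j <;> fin_cases i <;> fin_cases j <;> norm_num [luders, pvmX]
lemma XZ (x) : luders pvmX (pvmZ x) = (1 / 2 : ℂ) • 1 := by
  fin_cases x <;> ext i j <;> fin_cases i <;> fin_cases j <;> norm_num [luders, pvmX, pvmZ]
lemma ZX (x) : luders pvmZ (pvmX x) = (1 / 2 : ℂ) • 1 := by
  fin_cases x <;> ext i j <;> fin_cases i <;> fin_cases j <;> norm_num [luders, pvmX, pvmZ]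

/-- for the maximally mixed qubit state `ρ = I/2`, the modified measure gives
`𝔦(I/2, Z, X) = ln 2` and `𝔦(I/2, Z, Z) = 0`; hence in the QKD-like protocol where Alice and
Eve each choose `Z` or `X` with probability 1/2, the average leakage is
`𝔦_avg = (1/2) ln 2 ≠ 0`. -/
theorem stmt10 :
    modIPC ((1 / 2 : ℂ) • (1 : Matrix (Fin 2) (Fin 2) ℂ)) pvmZ pvmX = Real.log 2 ∧
    modIPC ((1 / 2 : ℂ) • (1 : Matrix (Fin 2) (Fin 2) ℂ)) pvmZ pvmZ = 0 ∧
    (1 / 4 : ℝ) *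
        (modIPC ((1 / 2 : ℂ) • (1 : Matrix (Fin 2) (Fin 2) ℂ)) pvmZ pvmZ
          + modIPC ((1 / 2 : ℂ) • (1 : Matrix (Fin 2) (Fin 2) ℂ)) pvmZ pvmX
          + modIPC ((1 / 2 : ℂ) • (1 : Matrix (Fin 2) (Fin 2) ℂ)) pvmX pvmZ
          + modIPC ((1 / 2 : ℂ) • (1 : Matrix (Fin 2) (Fin 2) ℂ)) pvmX pvmX)
      = (1 / 2 : ℝ) * Real.log 2 ∧
    (1 / 2 : ℝ) * Real.log 2 ≠ 0 := by
  have hl : Real.log 2 ≠ 0 := (Real.log_pos (by norm_num)).ne'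
  rw [modIPC_half pvmZ pvmX Z_i Z_s Z_t X_i X_s, modIPC_half pvmZ pvmZ Z_i Z_s Z_t Z_i Z_s,
    modIPC_half pvmX pvmZ X_i X_s X_t Z_i Z_s, modIPC_half pvmX pvmX X_i X_s X_t X_i X_s]
  simp only [ZZ, XX, XZ, ZX, vNE_half, vNE_idem _ (Z_i _), vNE_idem _ (X_i _)]
  refine ⟨by ring, by ring, by ring, ?_⟩
  exact mul_ne_zero (by norm_num) hl
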